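/- arXiv:2408.11718 — 7 statements merged into one kernel-verified Lean document; each statement's English description precedes it below -/
import Mathlib

section
/- Let p ≥ 1 and let E be a below-diagonal position set on {1,…,p}. Suppose L is a p×p real lower triangular matrix with positive diagonal entries such that for every pair (i,j) with 1 ≤ j < i ≤ p and (i,j) ∉ E, the entry L_ij satisfies L_ij = −(Σ_{k=1}^{j−1} L_ik · L_jk)/L_jj. Then the matrix Ω = L·Lᵀ is symmetric positive definite and satisfies Ω_ij = 0 for every pair i ≠ j whose below-diagonal representative is not in E (i.e., (max(i,j),min(i,j)) ∉ E). In other words, Ω lies in the set P_{G} of positive definite matrices with zero pattern given by the graph G encoded by E. -/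
open Matrix BigOperators

theorem Matrix.posDef_mul_transpose_self_of_lowerTriangular {n : Type*} [Fintype n]
    [LinearOrder n] {L : Matrix n n ℝ} (hupper : ∀ i j, i < j → L i j = 0)
    (hdiag : ∀ i, L i i ≠ 0) : (L * Lᵀ).PosDef := by
  have hdet : IsUnit L.det := by
    rw [Matrix.det_of_isLowerTriangular L fun i j h => hupper i j h]
    exact (Finset.prod_ne_zero_iff.mpr fun i _ => hdiag i).isUnit
  rw [← Matrix.conjTranspose_eq_transpose_of_trivial]
  exact Matrix.PosDef.mul_conjTranspose_self L
    (Matrix.vecMul_injective_of_isUnit ((Matrix.isUnit_iff_isUnit_det L).mpr hdet))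

theorem Matrix.mul_transpose_self_apply_of_lowerTriangular {n R : Type*} [Fintype n]
    [LinearOrder n] [LocallyFiniteOrderBot n] [CommSemiring R] {L : Matrix n n R}
    (hupper : ∀ i j, i < j → L i j = 0) (i j : n) :
    (L * Lᵀ) i j = L i j * L j j + ∑ k ∈ Finset.Iio j, L i k * L j k := by
  have hsum : ∑ k ∈ Finset.Iic j, L i k * L j k = (L * Lᵀ) i j :=
    Finset.sum_subset (Finset.subset_univ _) fun k _ hk => by
      rw [hupper j k (by simpa using hk), mul_zero]
  rw [← hsum, ← Finset.Iio_insert, Finset.sum_insert (by simp)]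

/-- **Lemma 1 (CCA output is positive definite with correct sparsity).**
Let `E` be a below-diagonal position set on `{1,…,p}` and let `L` be a lower
triangular matrix with positive diagonal whose entries at below-diagonal
positions outside `E` satisfy the CCA fill-in equation.  Then `Ω = L Lᵀ` is
positive definite and `Ω i j = 0` whenever `i ≠ j` and the below-diagonal
representative of `(i,j)` is not in `E`. -/
theorem stmt_0 (p : ℕ) (hp : 1 ≤ p) (E : Finset (Fin p × Fin p))
    (hE : ∀ e ∈ E, e.2 < e.1)
    (L : Matrix (Fin p) (Fin p) ℝ)
    (hupper : ∀ i j : Fin p, i < j → L i j = 0)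
    (hdiag : ∀ i : Fin p, 0 < L i i)
    (hfill : ∀ i j : Fin p, j < i → (i, j) ∉ E →
      L i j = -(∑ k ∈ Finset.Iio j, L i k * L j k) / L j j) :
    (L * Lᵀ).PosDef ∧
      ∀ i j : Fin p, i ≠ j → (max i j, min i j) ∉ E → (L * Lᵀ) i j = 0 := by
  refine ⟨posDef_mul_transpose_self_of_lowerTriangular hupper fun i => (hdiag i).ne', ?_⟩
  have hlower : ∀ i j : Fin p, j < i → (i, j) ∉ E → (L * Lᵀ) i j = 0 := fun i j hji hij => by
    rw [mul_transpose_self_apply_of_lowerTriangular hupper, hfill i j hji hij,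
      div_mul_cancel₀ _ (hdiag j).ne', neg_add_cancel]
  intro i j hne hij
  rcases hne.lt_or_gt with h | h
  · rw [max_eq_right h.le, min_eq_left h.le] at hij
    rw [← (isSymm_mul_transpose_self L).apply i j]
    exact hlower j i h hij
  · rw [max_eq_left h.le, min_eq_right h.le] at hij
    exact hlower i j h hij
end

section
/- Let p ≥ 1 and let E ⊆ E^D be two below-diagonal position sets on {1,…,p}. Suppose L and L′ are p×p real lower triangular matrices with positive diagonal entries such that: (i) L_ij = L′_ij = 0 for every (i,j) with 1 ≤ j < i ≤ p and (i,j) ∉ E^D; (ii) (L·Lᵀ)_ij = (L′·L′ᵀ)_ij = 0 for every (i,j) with 1 ≤ j < i ≤ p and (i,j) ∉ E; and (iii) L_ij = L′_ij for every (i,j) with i = j or (i,j) ∈ E. Then L = L′. -/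
open Matrix BigOperators

/-- **Uniqueness core of Lemma 2.**  A lower triangular matrix with positive
diagonal, support contained in `E^D ∪ diagonal`, and whose Gram matrix `L Lᵀ`
has zero pattern `E`, is uniquely determined by its entries on `E ∪ diagonal`. -/
theorem stmt_1 (p : ℕ) (hp : 1 ≤ p) (E ED : Finset (Fin p × Fin p))
    (hE : ∀ e ∈ E, e.2 < e.1) (hED : ∀ e ∈ ED, e.2 < e.1) (hsub : E ⊆ ED)
    (L L' : Matrix (Fin p) (Fin p) ℝ)
    (hLu : ∀ i j : Fin p, i < j → L i j = 0)
    (hL'u : ∀ i j : Fin p, i < j → L' i j = 0)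
    (hLd : ∀ i : Fin p, 0 < L i i) (hL'd : ∀ i : Fin p, 0 < L' i i)
    (hLsupp : ∀ i j : Fin p, j < i → (i, j) ∉ ED → L i j = 0)
    (hL'supp : ∀ i j : Fin p, j < i → (i, j) ∉ ED → L' i j = 0)
    (hLgram : ∀ i j : Fin p, j < i → (i, j) ∉ E → (L * Lᵀ) i j = 0)
    (hL'gram : ∀ i j : Fin p, j < i → (i, j) ∉ E → (L' * L'ᵀ) i j = 0)
    (hagree : ∀ i j : Fin p, i = j ∨ (i, j) ∈ E → L i j = L' i j) :
    L = L' := by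
  suffices h : ∀ j i, L i j = L' i j from Matrix.ext fun i j => h j i
  intro j
  induction j using WellFoundedLT.induction with
  | _ j ih =>
    intro i
    rcases lt_trichotomy i j with hij | hij | hij
    · rw [hLu i j hij, hL'u i j hij]
    · exact hagree i j (.inl hij)
    by_cases he : (i, j) ∈ E
    · exact hagree i j (.inr he)
    have hsum : ∑ k, (L i k * L j k - L' i k * L' j k) = 0 := by
      have h := hLgram i j hij he
      have h' := hL'gram i j hij he
      simp only [Matrix.mul_apply, Matrix.transpose_apply] at h h'
      rw [Finset.sum_sub_distrib, h, h', sub_zero]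
    rw [Finset.sum_eq_single j _ (by simp), ← hagree j j (.inl rfl), ← sub_mul] at hsum
    · exact sub_eq_zero.mp ((mul_eq_zero.mp hsum).resolve_right (hLd j).ne')
    · intro k _ hk
      rcases lt_or_gt_of_ne hk with hk | hk
      · rw [ih k hk i, ih k hk j, sub_self]
      · rw [hLu j k hk, hL'u j k hk, mul_zero, mul_zero, sub_zero]
end

section
/- Let p ≥ 1, let F be a below-diagonal position set on {1,…,p}, and let S be a p×p symmetric positive definite real matrix. For each j ∈ {1,…,p}, let N_j = {k : j < k ≤ p, (k,j) ∈ F}, let S^{>j} denote the principal submatrix of S with rows and columns indexed by N_j, and let S^>_{·j} denote the vector (S_kj)_{k∈N_j}. Then the function f(L) = trace(L·Lᵀ·S) − 2·Σ_{j=1}^p log(L_jj), defined on the set of p×p lower triangular matrices L with positive diagonal satisfying L_ij = 0 for all (i,j) with j < i and (i,j) ∉ F, attains its minimum at a unique matrix L̂, and the entries of L̂ are given in closed form by: L̂_jj = (S_jj − (S^>_{·j})ᵀ·(S^{>j})^{−1}·S^>_{·j})^{−1/2}, and for i ∈ N_j, the sub-vector (L̂_ij)_{i∈N_j} equals −(S^{>j})^{−1}·S^>_{·j}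 multiplied by L̂_jj. -/
open Matrix BigOperators

/-- The principal submatrix `S^{>j}` of `S` with rows and columns indexed by
`N_j = {k : j < k, (k,j) ∈ F}`. -/
def subMat {p : ℕ} (F : Finset (Fin p × Fin p)) (S : Matrix (Fin p) (Fin p) ℝ)
    (j : Fin p) : Matrix {k : Fin p // j < k ∧ (k, j) ∈ F} {k : Fin p // j < k ∧ (k, j) ∈ F} ℝ :=
  Matrix.of fun a b => S a.1 b.1

/-- The vector `S^>_{·j} = (S_{kj})_{k ∈ N_j}`. -/
def subVec {p : ℕ} (F : Finset (Fin p × Fin p)) (S : Matrix (Fin p) (Fin p) ℝ)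
    (j : Fin p) : {k : Fin p // j < k ∧ (k, j) ∈ F} → ℝ :=
  fun a => S a.1 j

/-- The Schur complement `S_{jj} - (S^>_{·j})ᵀ (S^{>j})⁻¹ S^>_{·j}`. -/
noncomputable def schurC {p : ℕ} (F : Finset (Fin p × Fin p))
    (S : Matrix (Fin p) (Fin p) ℝ) (j : Fin p) : ℝ :=
  S j j - subVec F S j ⬝ᵥ ((subMat F S j)⁻¹ *ᵥ subVec F S j)

/-- `L` is lower triangular with positive diagonal entries. -/
def lowerPos {p : ℕ} (L : Matrix (Fin p) (Fin p) ℝ) : Prop :=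
  (∀ i j : Fin p, i < j → L i j = 0) ∧ ∀ i : Fin p, 0 < L i i

/-- Feasible set: lower triangular with positive diagonal, below-diagonal support
contained in `F`. -/
def feasF {p : ℕ} (F : Finset (Fin p × Fin p)) (L : Matrix (Fin p) (Fin p) ℝ) : Prop :=
  lowerPos L ∧ ∀ i j : Fin p, j < i → (i, j) ∉ F → L i j = 0

/-- The objective `f(L) = trace(L Lᵀ S) - 2 ∑_j log L_{jj}`. -/
noncomputable def objf {p : ℕ} (S L : Matrix (Fin p) (Fin p) ℝ) : ℝ :=
  Matrix.trace (L * Lᵀ * S) - 2 * ∑ j : Fin p, Real.log (L j j)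

/-- The vector `e_j - (S^{>j})⁻¹ S^>_{·j}`, with the second term extended by zero outside `N_j`. -/
noncomputable def colDir {p : ℕ} (F : Finset (Fin p × Fin p)) (S : Matrix (Fin p) (Fin p) ℝ)
    (j : Fin p) : Fin p → ℝ :=
  fun i => (if i = j then 1 else 0) -
    if h : j < i ∧ (i, j) ∈ F then ((subMat F S j)⁻¹ *ᵥ subVec F S j) ⟨i, h⟩ else 0

lemma colDir_self {p : ℕ} (F : Finset (Fin p × Fin p)) (S : Matrix (Fin p) (Fin p) ℝ)
    (j : Fin p) : colDir F S j j = 1 := by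
  simp [colDir]

lemma colDir_of_mem {p : ℕ} (F : Finset (Fin p × Fin p)) (S : Matrix (Fin p) (Fin p) ℝ)
    {j i : Fin p} (h : j < i ∧ (i, j) ∈ F) :
    colDir F S j i = -(((subMat F S j)⁻¹ *ᵥ subVec F S j) ⟨i, h⟩) := by
  simp [colDir, h, h.1.ne']

lemma colDir_of_notMem {p : ℕ} (F : Finset (Fin p × Fin p)) (S : Matrix (Fin p) (Fin p) ℝ)
    {j i : Fin p} (hij : i ≠ j) (h : ¬(j < i ∧ (i, j) ∈ F)) : colDir F S j i = 0 := by
  simp only [colDir, dif_neg h, if_neg hij, sub_zero]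

lemma mulVec_colDir {p : ℕ} (F : Finset (Fin p × Fin p)) (S : Matrix (Fin p) (Fin p) ℝ)
    (j k : Fin p) :
    (S *ᵥ colDir F S j) k =
      S k j - ∑ a : {i : Fin p // j < i ∧ (i, j) ∈ F},
        S k a.1 * ((subMat F S j)⁻¹ *ᵥ subVec F S j) a := by
  rw [mulVec, dotProduct]
  simp only [colDir, mul_sub, Finset.sum_sub_distrib, mul_ite, mul_one,
    mul_zero, Finset.sum_ite_eq', Finset.mem_univ, if_true, mul_dite]
  rw [Finset.sum_dite, Finset.sum_const_zero, add_zero]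
  congr 1
  exact Finset.sum_bij (fun a _ => ⟨a.1, (Finset.mem_filter.1 a.2).2⟩)
    (fun _ _ => Finset.mem_univ _)
    (fun a _ b _ h => Subtype.ext (Subtype.mk.inj h))
    (fun b _ => ⟨⟨b.1, by simpa using b.2⟩, Finset.mem_attach _ _, rfl⟩) (fun _ _ => rfl)

lemma mulVec_colDir_of_mem {p : ℕ} (F : Finset (Fin p × Fin p))
    {S : Matrix (Fin p) (Fin p) ℝ} (hS : S.PosDef) {j k : Fin p} (h : j < k ∧ (k, j) ∈ F) :
    (S *ᵥ colDir F S j) k = 0 := by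
  have hM : (subMat F S j).PosDef := hS.submatrix Subtype.val_injective
  have hdet : IsUnit (subMat F S j).det := (isUnit_iff_isUnit_det _).1 hM.isUnit
  have key : subMat F S j *ᵥ ((subMat F S j)⁻¹ *ᵥ subVec F S j) = subVec F S j := by
    rw [mulVec_mulVec, mul_nonsing_inv _ hdet, one_mulVec]
  have key' := congrFun key ⟨k, h⟩
  rw [mulVec_colDir, sub_eq_zero]
  exact key'.symm

lemma mulVec_colDir_self {p : ℕ} (F : Finset (Fin p × Fin p))
    {S : Matrix (Fin p) (Fin p) ℝ} (hS : S.PosDef) (j : Fin p) :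
    (S *ᵥ colDir F S j) j = schurC F S j := by
  rw [mulVec_colDir, schurC]
  congr 1
  refine Finset.sum_congr rfl fun a _ => ?_
  rw [subVec, ← hS.isHermitian.apply a.1 j, star_trivial]

lemma dotProduct_mulVec_colDir {p : ℕ} (F : Finset (Fin p × Fin p))
    {S : Matrix (Fin p) (Fin p) ℝ} (hS : S.PosDef) {j : Fin p} {x : Fin p → ℝ}
    (hx : ∀ i, i ≠ j → ¬(j < i ∧ (i, j) ∈ F) → x i = 0) :
    x ⬝ᵥ (S *ᵥ colDir F S j) = x j * schurC F S j := by
  rw [dotProduct, Finset.sum_eq_single j, mulVec_colDir_self F hS]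
  · intro i _ hij
    by_cases h : j < i ∧ (i, j) ∈ F
    · rw [mulVec_colDir_of_mem F hS h, mul_zero]
    · rw [hx i hij h, zero_mul]
  · simp

lemma schurC_pos {p : ℕ} (F : Finset (Fin p × Fin p))
    {S : Matrix (Fin p) (Fin p) ℝ} (hS : S.PosDef) (j : Fin p) : 0 < schurC F S j := by
  have h0 : colDir F S j ≠ 0 := fun h => by simpa [colDir_self] using congrFun h j
  have h1 := hS.dotProduct_mulVec_pos h0
  rwa [star_trivial, dotProduct_mulVec_colDir F hS fun _ => colDir_of_notMem F S, colDir_self,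
    one_mul] at h1

lemma dotProduct_mulVec_eq_add {p : ℕ} (F : Finset (Fin p × Fin p))
    {S : Matrix (Fin p) (Fin p) ℝ} (hS : S.PosDef) {j : Fin p} {x : Fin p → ℝ}
    (hx : ∀ i, i ≠ j → ¬(j < i ∧ (i, j) ∈ F) → x i = 0) :
    x ⬝ᵥ (S *ᵥ x) = schurC F S j * x j ^ 2 +
      (x - x j • colDir F S j) ⬝ᵥ (S *ᵥ (x - x j • colDir F S j)) := by
  have hT : Sᵀ = S := by simpa [IsHermitian, conjTranspose_eq_transpose_of_trivial] using hS.1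
  have hxw := dotProduct_mulVec_colDir F hS hx
  have hww := dotProduct_mulVec_colDir F hS (x := colDir F S j) fun _ => colDir_of_notMem F S
  have hwx : colDir F S j ⬝ᵥ (S *ᵥ x) = x j * schurC F S j := by
    rw [← hxw, dotProduct_mulVec, ← mulVec_transpose, hT, dotProduct_comm]
  rw [colDir_self, one_mul] at hww
  simp only [mulVec_sub, mulVec_smul, sub_dotProduct, dotProduct_sub, smul_dotProduct,
    dotProduct_smul, smul_eq_mul, hxw, hww, hwx]
  ring

/-- The contribution of a single column `x`, with diagonal position `j`, to the objective. -/
noncomputable def colCost {p : ℕ} (S : Matrix (Fin p) (Fin p) ℝ) (j : Fin p)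
    (x : Fin p → ℝ) : ℝ :=
  x ⬝ᵥ (S *ᵥ x) - 2 * Real.log (x j)

lemma objf_eq_sum_colCost {p : ℕ} (S L : Matrix (Fin p) (Fin p) ℝ) :
    objf S L = ∑ j, colCost S j (L.col j) := by
  simp only [objf, colCost, Finset.sum_sub_distrib, ← Finset.mul_sum, col_apply]
  congr 1
  rw [Matrix.mul_assoc, trace_mul_comm, trace]
  refine Finset.sum_congr rfl fun j _ => ?_
  rw [diag_apply, Matrix.mul_assoc]
  rfl

lemma one_add_log_le_mul_sq_sub_log {c t : ℝ} (hc : 0 < c) (ht : 0 < t) :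
    1 + Real.log c ≤ c * t ^ 2 - 2 * Real.log t := by
  have h := Real.log_le_sub_one_of_pos (show 0 < c * t ^ 2 by positivity)
  rw [Real.log_mul hc.ne' (by positivity), Real.log_pow] at h
  push_cast at h
  linarith

lemma eq_one_div_sqrt_of_mul_sq_sub_log_le {c t : ℝ} (hc : 0 < c) (ht : 0 < t)
    (h : c * t ^ 2 - 2 * Real.log t ≤ 1 + Real.log c) : t = 1 / Real.sqrt c := by
  have h1 : c * t ^ 2 = 1 := by
    by_contra hne
    have h2 := Real.log_lt_sub_one_of_pos (show 0 < c * t ^ 2 by positivity) hne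
    rw [Real.log_mul hc.ne' (by positivity), Real.log_pow] at h2
    push_cast at h2
    linarith
  have hs : 0 < Real.sqrt c := Real.sqrt_pos.2 hc
  rw [eq_div_iff hs.ne', ← sq_eq_sq₀ (by positivity) zero_le_one, mul_pow, Real.sq_sqrt hc.le]
  linarith

lemma one_add_log_le_colCost {p : ℕ} (F : Finset (Fin p × Fin p))
    {S : Matrix (Fin p) (Fin p) ℝ} (hS : S.PosDef) {j : Fin p} {x : Fin p → ℝ}
    (hx : ∀ i, i ≠ j → ¬(j < i ∧ (i, j) ∈ F) → x i = 0) (hj : 0 < x j) :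
    1 + Real.log (schurC F S j) ≤ colCost S j x := by
  have h1 := hS.posSemidef.dotProduct_mulVec_nonneg (x - x j • colDir F S j)
  rw [star_trivial] at h1
  have h2 := one_add_log_le_mul_sq_sub_log (schurC_pos F hS j) hj
  rw [colCost, dotProduct_mulVec_eq_add F hS hx]
  linarith

lemma eq_smul_colDir_of_colCost_le {p : ℕ} (F : Finset (Fin p × Fin p))
    {S : Matrix (Fin p) (Fin p) ℝ} (hS : S.PosDef) {j : Fin p} {x : Fin p → ℝ}
    (hx : ∀ i, i ≠ j → ¬(j < i ∧ (i, j) ∈ F) → x i = 0) (hj : 0 < x j)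
    (h : colCost S j x ≤ 1 + Real.log (schurC F S j)) :
    x = (1 / Real.sqrt (schurC F S j)) • colDir F S j := by
  have h1 := hS.posSemidef.dotProduct_mulVec_nonneg (x - x j • colDir F S j)
  rw [star_trivial] at h1
  have h2 := one_add_log_le_mul_sq_sub_log (schurC_pos F hS j) hj
  rw [colCost, dotProduct_mulVec_eq_add F hS hx] at h
  have ht := eq_one_div_sqrt_of_mul_sq_sub_log_le (schurC_pos F hS j) hj (by linarith)
  rw [← ht, ← sub_eq_zero]
  by_contra hne
  have h3 := hS.dotProduct_mulVec_pos hne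
  rw [star_trivial] at h3
  linarith

lemma colCost_smul_colDir {p : ℕ} (F : Finset (Fin p × Fin p))
    {S : Matrix (Fin p) (Fin p) ℝ} (hS : S.PosDef) (j : Fin p) :
    colCost S j ((1 / Real.sqrt (schurC F S j)) • colDir F S j) =
      1 + Real.log (schurC F S j) := by
  have hc := schurC_pos F hS j
  have hww := dotProduct_mulVec_colDir F hS (x := colDir F S j) fun _ => colDir_of_notMem F S
  rw [colDir_self, one_mul] at hww
  simp only [colCost, mulVec_smul, smul_dotProduct, dotProduct_smul, smul_eq_mul, hww,
    Pi.smul_apply, colDir_self, mul_one, one_div, Real.log_inv, Real.log_sqrt hc.le]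
  have hs : (Real.sqrt (schurC F S j))⁻¹ * ((Real.sqrt (schurC F S j))⁻¹ * schurC F S j) = 1 := by
    rw [← mul_assoc, ← mul_inv, Real.mul_self_sqrt hc.le, inv_mul_cancel₀ hc.ne']
  rw [hs]
  ring

lemma feasF.col_eq_zero {p : ℕ} {F : Finset (Fin p × Fin p)} {L : Matrix (Fin p) (Fin p) ℝ}
    (hL : feasF F L) (j i : Fin p) (hij : i ≠ j) (h : ¬(j < i ∧ (i, j) ∈ F)) :
    L.col j i = 0 := by
  rcases lt_or_gt_of_ne hij with hlt | hgt
  · exact hL.1.1 i j hlt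
  · exact hL.2 i j hgt fun hF => h ⟨hgt, hF⟩

/-- **Step I of CCA (eqs. (1) and (4) of the paper).**  For positive definite `S`,
the function `f` attains its minimum over the lower triangular matrices with
positive diagonal and sparsity pattern `F` at a unique matrix `L̂`, whose entries
are given in closed form by Schur-complement formulas. -/
theorem stmt_3 (p : ℕ) (hp : 1 ≤ p) (F : Finset (Fin p × Fin p))
    (hF : ∀ e ∈ F, e.2 < e.1)
    (S : Matrix (Fin p) (Fin p) ℝ) (hS : S.PosDef) :
    ∃ Lh : Matrix (Fin p) (Fin p) ℝ,
      feasF F Lh ∧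
      (∀ L, feasF F L → objf S Lh ≤ objf S L) ∧
      (∀ L', feasF F L' → (∀ L, feasF F L → objf S L' ≤ objf S L) → L' = Lh) ∧
      (∀ j : Fin p, Lh j j = 1 / Real.sqrt (schurC F S j)) ∧
      (∀ j i : Fin p, ∀ h : j < i ∧ (i, j) ∈ F,
        Lh i j = -(((subMat F S j)⁻¹ *ᵥ subVec F S j) ⟨i, h⟩) * Lh j j) := by
  set Lh : Matrix (Fin p) (Fin p) ℝ :=
    of fun i j => (1 / Real.sqrt (schurC F S j)) * colDir F S j i with hLh
  have hcol : ∀ j, Lh.col j = (1 / Real.sqrt (schurC F S j)) • colDir F S j := fun j => rfl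
  have hdiag : ∀ j, Lh j j = 1 / Real.sqrt (schurC F S j) := fun j => by
    rw [hLh, of_apply, colDir_self, mul_one]
  have hzero : ∀ i j, i ≠ j → ¬(j < i ∧ (i, j) ∈ F) → Lh i j = 0 := fun i j hij h => by
    rw [hLh, of_apply, colDir_of_notMem F S hij h, mul_zero]
  have hfeas : feasF F Lh :=
    ⟨⟨fun i j hij => hzero i j hij.ne fun h => h.1.not_gt hij, fun j => by
      rw [hdiag]
      exact one_div_pos.2 (Real.sqrt_pos.2 (schurC_pos F hS j))⟩,
      fun i j hij h => hzero i j hij.ne' fun h' => h h'.2⟩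
  have hobj : objf S Lh = ∑ j, (1 + Real.log (schurC F S j)) := by
    rw [objf_eq_sum_colCost]
    exact Finset.sum_congr rfl fun j _ => by rw [hcol, colCost_smul_colDir F hS]
  have hle : ∀ L, feasF F L → ∀ j ∈ Finset.univ,
      1 + Real.log (schurC F S j) ≤ colCost S j (L.col j) := fun L hL j _ =>
    one_add_log_le_colCost F hS (hL.col_eq_zero j) (hL.1.2 j)
  refine ⟨Lh, hfeas, fun L hL => ?_, fun L' hL' hmin => ?_, hdiag, fun j i h => ?_⟩
  · rw [hobj, objf_eq_sum_colCost]
    exact Finset.sum_le_sum (hle L hL)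
  · have hge := hmin Lh hfeas
    rw [hobj, objf_eq_sum_colCost] at hge
    have heq := (Finset.sum_eq_sum_iff_of_le (hle L' hL')).1
      (le_antisymm (Finset.sum_le_sum (hle L' hL')) hge)
    ext i j
    have hj := eq_smul_colDir_of_colCost_le F hS (hL'.col_eq_zero j) (hL'.1.2 j)
      (heq j (Finset.mem_univ j)).ge
    exact congrFun hj i
  · rw [hdiag, hLh, of_apply, colDir_of_mem F S h, mul_comm]
end

section
/- For p ∈ ℕ, let c_p = p(p−1)/2 and let 𝒜_p denote the collection of simple graphs on the labeled vertex set {1,…,p} with strictly more than p^{5/3} edges; equivalently |𝒜_p| is the number of subsets of a c_p-element set of cardinality strictly greater than p^{5/3}. Then for every p ≥ 100, |𝒜_p| / 2^{c_p} ≥ 1 − √(2/π) · exp(−(0.17·p² − 3·p^{5/3}·log p)), where log denotes the natural logarithm. -/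
open BigOperators

/-- Chernoff-type bound: the number of subsets of a finite type with at most `t` elements is at most
`a ^ t * (1 + 1 / a) ^ n`, for every `a ≥ 1`. -/
theorem card_filter_card_le_rpow {α : Type*} [Fintype α] {a t : ℝ} (ha : 1 ≤ a) :
    (((Finset.univ : Finset α).powerset.filter
      (fun s : Finset α => ¬ t < (s.card : ℝ))).card : ℝ) ≤
      a ^ t * (1 + 1 / a) ^ Fintype.card α := by
  have ha0 : 0 < a := by linarith
  have hsum : ∑ s ∈ (Finset.univ : Finset α).powerset, (1 / a) ^ s.card =
      (1 + 1 / a) ^ Fintype.card α := by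
    have h := Finset.sum_pow_mul_eq_add_pow (1 / a) 1 (Finset.univ : Finset α)
    simp only [one_pow, mul_one, Finset.card_univ] at h
    rw [h, add_comm]
  rw [← hsum, Finset.mul_sum, Finset.card_eq_sum_ones, Nat.cast_sum]
  refine (Finset.sum_le_sum fun s hs => ?_).trans
    (Finset.sum_le_sum_of_subset_of_nonneg (Finset.filter_subset _ _)
      fun s _ _ => by positivity)
  have hs' : (s.card : ℝ) ≤ t := not_lt.mp (Finset.mem_filter.mp hs).2
  rw [one_div, inv_pow, ← div_eq_mul_inv, Nat.cast_one, one_le_div (by positivity),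
    ← Real.rpow_natCast]
  exact Real.rpow_le_rpow_of_exponent_le ha hs'

theorem exp_neg_one_le_sqrt_two_div_pi : Real.exp (-1) ≤ Real.sqrt (2 / Real.pi) := by
  have h1 : Real.exp (-1) ≤ 1 / 2 := by
    rw [Real.exp_neg, ← one_div]
    exact one_div_le_one_div_of_le two_pos (by linarith [Real.add_one_le_exp (1 : ℝ)])
  refine h1.trans (Real.le_sqrt_of_sq_le ?_)
  rw [le_div_iff₀ Real.pi_pos]
  linarith [Real.pi_le_four]

theorem cast_mul_pred_div_two {p : ℕ} (hp : 1 ≤ p) :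
    ((p * (p - 1) / 2 : ℕ) : ℝ) = (p : ℝ) * (p - 1) / 2 := by
  rw [Nat.cast_div (Nat.even_mul_pred_self p).two_dvd (by norm_num)]
  push_cast [Nat.cast_sub hp]
  rfl

/-- **Lemma 6(b), explicit bound.**  Identifying simple graphs on `{1,…,p}` with
subsets of a `c_p`-element set, where `c_p = p(p-1)/2`, the proportion of graphs
with strictly more than `p^{5/3}` edges is at least
`1 - √(2/π) · exp(-(0.17 p² - 3 p^{5/3} log p))` for every `p ≥ 100`. -/
theorem stmt_6 (p : ℕ) (hp : 100 ≤ p) :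
    (((Finset.univ.powerset.filter
        (fun s : Finset (Fin (p * (p - 1) / 2)) =>
          (p : ℝ) ^ ((5 : ℝ) / 3) < (s.card : ℝ))).card : ℝ)) /
      2 ^ (p * (p - 1) / 2) ≥
    1 - Real.sqrt (2 / Real.pi) *
      Real.exp (-(0.17 * (p : ℝ) ^ 2 - 3 * (p : ℝ) ^ ((5 : ℝ) / 3) * Real.log p)) := by
  have hp' : (100 : ℝ) ≤ p := by exact_mod_cast hp
  have hp0 : (0 : ℝ) < p := by linarith
  have hN := cast_mul_pred_div_two (p := p) (by omega)
  generalize p * (p - 1) / 2 = N at hN ⊢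
  generalize ht : (p : ℝ) ^ ((5 : ℝ) / 3) = t
  have ht0 : 0 ≤ t := ht ▸ by positivity
  have hlog : 0 ≤ Real.log p := Real.log_nonneg (by linarith)
  have hsmall := card_filter_card_le_rpow (α := Fin N) (a := p) (t := t) (by linarith)
  rw [Fintype.card_fin] at hsmall
  have hcompl := Finset.card_filter_add_card_filter_not (s := (Finset.univ : Finset (Fin N)).powerset)
    (fun s : Finset (Fin N) => t < (s.card : ℝ))
  rw [Finset.card_powerset, Finset.card_univ, Fintype.card_fin] at hcompl
  have hcompl' := congrArg (Nat.cast : ℕ → ℝ) hcompl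
  push_cast at hcompl'
  have htwo : (2 : ℝ) ^ N = Real.exp (N * Real.log 2) := by
    rw [Real.exp_nat_mul, Real.exp_log two_pos]
  have hpow : (1 + 1 / (p : ℝ)) ^ N ≤ Real.exp (N * (1 / p)) := by
    rw [Real.exp_nat_mul]
    exact pow_le_pow_left₀ (by positivity) (by linarith [Real.add_one_le_exp (1 / (p : ℝ))]) N
  have hNp : (N : ℝ) * (1 / p) = (p - 1) / 2 := by
    rw [hN]
    field_simp
  have hNlog : (N : ℝ) * 0.693 ≤ N * Real.log 2 :=
    mul_le_mul_of_nonneg_left (by linarith [Real.log_two_gt_d9]) N.cast_nonneg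
  have hexponent : Real.log p * t + N * (1 / p) ≤
      -1 + -(0.17 * (p : ℝ) ^ 2 - 3 * t * Real.log p) + N * Real.log 2 := by
    rw [hN] at hNlog
    rw [hNp, hN]
    nlinarith [mul_nonneg ht0 hlog]
  have hbound : (p : ℝ) ^ t * (1 + 1 / (p : ℝ)) ^ N ≤ Real.sqrt (2 / Real.pi) *
      Real.exp (-(0.17 * (p : ℝ) ^ 2 - 3 * t * Real.log p)) * 2 ^ N := by
    calc (p : ℝ) ^ t * (1 + 1 / (p : ℝ)) ^ N
        ≤ Real.exp (Real.log p * t) * Real.exp (N * (1 / p)) := by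
          rw [Real.rpow_def_of_pos hp0]
          gcongr
      _ ≤ Real.exp (-1) * Real.exp (-(0.17 * (p : ℝ) ^ 2 - 3 * t * Real.log p)) *
            Real.exp (N * Real.log 2) := by
          simp only [← Real.exp_add]
          exact Real.exp_le_exp.mpr hexponent
      _ ≤ _ := by
          rw [htwo]
          gcongr
          exact exp_neg_one_le_sqrt_two_div_pi
  rw [ge_iff_le, le_div_iff₀ (by positivity), sub_mul, one_mul]
  linarith
end

section
/- Let p ≥ 1 and let E be a below-diagonal position set on {1,…,p} satisfying the perfect elimination property: for all indices k < j < i, if (i,k) ∈ E and (j,k) ∈ E then (i,j) ∈ E. Let U and Δ be p×p real lower triangular matrices satisfying U_ij = Δ_ij = 0 for every (i,j) with 1 ≤ j < i ≤ p and (i,j) ∉ E. Then the product U·Δᵀ satisfies (U·Δᵀ)_ij = 0 for every pair i ≠ j with (max(i,j),min(i,j)) ∉ E. -/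
open Matrix BigOperators

/-- Under perfect elimination, rows `i` and `j < i` of two lower triangular matrices supported
on `E` have disjoint supports whenever `(i, j) ∉ E`. -/
theorem mul_eq_zero_of_perfect_elimination {ι R : Type*} [LinearOrder ι] [MulZeroClass R]
    {E : Set (ι × ι)}
    (hperf : ∀ i j k : ι, k < j → j < i → (i, k) ∈ E → (j, k) ∈ E → (i, j) ∈ E)
    {A B : Matrix ι ι R} (hBu : ∀ i j : ι, i < j → B i j = 0)
    (hAE : ∀ i j : ι, j < i → (i, j) ∉ E → A i j = 0)
    (hBE : ∀ i j : ι, j < i → (i, j) ∉ E → B i j = 0)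
    {i j : ι} (hji : j < i) (hij : (i, j) ∉ E) (k : ι) : A i k * B j k = 0 := by
  rcases lt_trichotomy k j with hkj | rfl | hjk
  · by_cases hik : (i, k) ∈ E
    · rw [hBE j k hkj fun hjk => hij (hperf i j k hkj hji hik hjk), mul_zero]
    · rw [hAE i k (hkj.trans hji) hik, zero_mul]
  · rw [hAE i k hji hij, zero_mul]
  · rw [hBu j k hjk, mul_zero]

/-- **Sparsity closure under perfect elimination.**  If `E` satisfies the perfect
elimination property and `U`, `Δ` are lower triangular matrices with
below-diagonal support contained in `E`, then the product `U Δᵀ` vanishes at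
every off-diagonal position whose below-diagonal representative is not in `E`. -/
theorem stmt_11 (p : ℕ) (hp : 1 ≤ p) (E : Finset (Fin p × Fin p))
    (hE : ∀ e ∈ E, e.2 < e.1)
    (hperf : ∀ i j k : Fin p, k < j → j < i → (i, k) ∈ E → (j, k) ∈ E → (i, j) ∈ E)
    (U Δ : Matrix (Fin p) (Fin p) ℝ)
    (hUu : ∀ i j : Fin p, i < j → U i j = 0)
    (hΔu : ∀ i j : Fin p, i < j → Δ i j = 0)
    (hUE : ∀ i j : Fin p, j < i → (i, j) ∉ E → U i j = 0)
    (hΔE : ∀ i j : Fin p, j < i → (i, j) ∉ E → Δ i j = 0) :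
    ∀ i j : Fin p, i ≠ j → (max i j, min i j) ∉ E → (U * Δᵀ) i j = 0 := by
  intro i j hne hij
  rw [mul_apply]
  refine Finset.sum_eq_zero fun k _ => ?_
  rw [transpose_apply]
  rcases hne.lt_or_gt with h | h
  · rw [max_eq_right h.le, min_eq_left h.le] at hij
    rw [mul_comm]
    exact mul_eq_zero_of_perfect_elimination (E := E) hperf hUu hΔE hUE h hij k
  · rw [max_eq_left h.le, min_eq_right h.le] at hij
    exact mul_eq_zero_of_perfect_elimination (E := E) hperf hΔu hUE hΔE h hij k
end

section
/- Let p ≥ 1 and let M be a p×p real matrix. Let r = max over rows i of the number of indices j with M_ij ≠ 0. Then the ℓ²→ℓ² operator norm of M satisfies ∥M∥₂² ≤ r · max_{1≤j≤p} Σ_{i=1}^p M_ij², i.e., the squared operator norm is at most the maximal number of nonzero entries in a row times the maximal squared Euclidean norm of a column. -/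
open Matrix BigOperators

/-- Cauchy–Schwarz for one row of `M`, restricted to the support of that row. -/
theorem Matrix.mulVec_sq_le_card_support_mul_sum {m n : Type*} [Fintype n]
    (M : Matrix m n ℝ) (x : n → ℝ) (i : m) :
    (M *ᵥ x) i ^ 2 ≤
      ((Finset.univ.filter fun j => M i j ≠ 0).card : ℝ) * ∑ j, M i j ^ 2 * x j ^ 2 := by
  have h1 : (M *ᵥ x) i = ∑ j ∈ Finset.univ.filter fun j => M i j ≠ 0, M i j * x j := by
    rw [Finset.sum_filter_of_ne fun j _ h => left_ne_zero_of_mul h]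
    rfl
  rw [h1]
  refine sq_sum_le_card_mul_sum_sq.trans ?_
  gcongr
  simp_rw [mul_pow]
  exact Finset.sum_le_sum_of_subset_of_nonneg (Finset.filter_subset _ _)
    fun j _ _ => by positivity

/-- If every row of `M` has at most `r` nonzero entries and every column has squared Euclidean
norm at most `C`, then `‖M x‖² ≤ r C ‖x‖²`. -/
theorem Matrix.sum_mulVec_sq_le {m n : Type*} [Fintype m] [Fintype n]
    (M : Matrix m n ℝ) (x : n → ℝ) {r : ℕ} {C : ℝ}
    (hr : ∀ i, (Finset.univ.filter fun j => M i j ≠ 0).card ≤ r)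
    (hC : ∀ j, ∑ i, M i j ^ 2 ≤ C) :
    ∑ i, (M *ᵥ x) i ^ 2 ≤ r * C * ∑ j, x j ^ 2 := by
  calc ∑ i, (M *ᵥ x) i ^ 2
      ≤ ∑ i, (r : ℝ) * ∑ j, M i j ^ 2 * x j ^ 2 := by
        refine Finset.sum_le_sum fun i _ => (M.mulVec_sq_le_card_support_mul_sum x i).trans ?_
        exact mul_le_mul_of_nonneg_right (by exact_mod_cast hr i)
          (Finset.sum_nonneg fun j _ => by positivity)
    _ = r * ∑ j, (∑ i, M i j ^ 2) * x j ^ 2 := by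
        rw [← Finset.mul_sum, Finset.sum_comm]
        simp_rw [Finset.sum_mul]
    _ ≤ r * ∑ j, C * x j ^ 2 := by
        gcongr with j
        exact hC j
    _ = r * C * ∑ j, x j ^ 2 := by rw [← Finset.mul_sum, mul_assoc]

/-- **Operator norm bound via row sparsity and column norms (proof of Theorem 1(a)).**
For a `p × p` real matrix `M`, the squared `ℓ² → ℓ²` operator norm of `M` is at most
the maximal number of nonzero entries in a row times the maximal squared Euclidean
norm of a column. -/
theorem stmt_12 (p : ℕ) (hp : 1 ≤ p) (M : Matrix (Fin p) (Fin p) ℝ) :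
    ‖Matrix.toEuclideanCLM (𝕜 := ℝ) M‖ ^ 2 ≤
      ((Finset.univ.sup fun i : Fin p =>
          (Finset.univ.filter fun j : Fin p => M i j ≠ 0).card : ℕ) : ℝ) *
        ⨆ j : Fin p, ∑ i : Fin p, M i j ^ 2 := by
  have hnonneg : 0 ≤ ⨆ j : Fin p, ∑ i : Fin p, M i j ^ 2 :=
    Real.iSup_nonneg fun j => Finset.sum_nonneg fun i _ => sq_nonneg _
  refine (Real.le_sqrt (norm_nonneg _) (by positivity)).mp ?_
  refine ContinuousLinearMap.opNorm_le_bound _ (Real.sqrt_nonneg _) fun x => ?_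
  refine le_of_sq_le_sq ?_ (by positivity)
  rw [mul_pow, Real.sq_sqrt (by positivity), EuclideanSpace.real_norm_sq_eq,
    EuclideanSpace.real_norm_sq_eq, Matrix.ofLp_toEuclideanCLM]
  refine M.sum_mulVec_sq_le _ (fun i => ?_) fun j => ?_
  · exact Finset.le_sup (f := fun i => (Finset.univ.filter fun j => M i j ≠ 0).card)
      (Finset.mem_univ i)
  · exact le_ciSup (f := fun j => ∑ i, M i j ^ 2) (Set.finite_range _).bddAbove j
end

section
/- Let p ≥ 5 and let L be a p×p real lower triangular matrix with nonzero diagonal entries, whose below-diagonal support is contained in the two bands directly below the diagonal: L_ik = 0 whenever k < i − 2. Suppose that (L·Lᵀ)_{i,i−1} = 0 for every i with 3 ≤ i ≤ p−1. Then L_{32} = −L_{21}·L_{31}/L_{22}, and for every i with 4 ≤ i ≤ p−1, L_{i,i−1} = (−1)^{i−2} · L_{i,i−2} · (L_{21}/L_{22}) · Π_{j=3}^{i−1} (L_{j,j−2} / L_{jj}). -/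
open BigOperators

/-- Two consecutive rows of a lower triangular matrix of lower bandwidth two overlap in
only two columns, so their inner product has two terms. -/
lemma sum_consecutive_rows_of_banded {R : Type*} [CommRing R] (p n : ℕ) (hn : n + 3 ≤ p)
    (L : ℕ → ℕ → R)
    (hupper : ∀ i j, 1 ≤ i → i ≤ p → 1 ≤ j → j ≤ p → i < j → L i j = 0)
    (hband : ∀ i k, 1 ≤ i → i ≤ p → 1 ≤ k → k ≤ p → k < i - 2 → L i k = 0) :
    ∑ k ∈ Finset.Icc 1 p, L (n + 3) k * L (n + 2) k =
      L (n + 3) (n + 1) * L (n + 2) (n + 1) + L (n + 3) (n + 2) * L (n + 2) (n + 2) := by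
  rw [← Finset.sum_pair (f := fun k => L (n + 3) k * L (n + 2) k)
    (show n + 1 ≠ n + 2 by omega)]
  symm
  apply Finset.sum_subset
  · intro k hk
    simp only [Finset.mem_insert, Finset.mem_singleton] at hk
    simp only [Finset.mem_Icc]
    omega
  · intro k hk hk'
    simp only [Finset.mem_insert, Finset.mem_singleton] at hk'
    rw [Finset.mem_Icc] at hk
    rcases lt_or_ge k (n + 1) with h | h
    · rw [hband (n + 3) k (by omega) hn hk.1 hk.2 (by omega), zero_mul]
    · rw [hupper (n + 2) k (by omega) (by omega) hk.1 hk.2 (by omega), mul_zero]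

/-- **Fill-in recursion for the p-cycle (equations (S.16)–(S.17)).**
Here `L i j` (for `1 ≤ i, j ≤ p`, one-based indexing) denotes the entries of a
`p × p` real lower triangular matrix with nonzero diagonal whose below-diagonal
support is contained in the two bands directly below the diagonal, and whose
Gram matrix `L Lᵀ` satisfies `(L Lᵀ)_{i,i-1} = 0` for `3 ≤ i ≤ p-1`.  Then
`L_{32} = -L_{21} L_{31} / L_{22}` and, for `4 ≤ i ≤ p-1`,
`L_{i,i-1} = (-1)^{i-2} L_{i,i-2} (L_{21}/L_{22}) ∏_{j=3}^{i-1} (L_{j,j-2}/L_{jj})`. -/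
theorem stmt_15 (p : ℕ) (hp : 5 ≤ p) (L : ℕ → ℕ → ℝ)
    (hupper : ∀ i j, 1 ≤ i → i ≤ p → 1 ≤ j → j ≤ p → i < j → L i j = 0)
    (hdiag : ∀ i, 1 ≤ i → i ≤ p → L i i ≠ 0)
    (hband : ∀ i k, 1 ≤ i → i ≤ p → 1 ≤ k → k ≤ p → k < i - 2 → L i k = 0)
    (hgram : ∀ i, 3 ≤ i → i ≤ p - 1 →
      ∑ k ∈ Finset.Icc 1 p, L i k * L (i - 1) k = 0) :
    L 3 2 = -(L 2 1 * L 3 1) / L 2 2 ∧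
    ∀ i, 4 ≤ i → i ≤ p - 1 →
      L i (i - 1) = (-1 : ℝ) ^ (i - 2) * L i (i - 2) * (L 2 1 / L 2 2) *
        ∏ j ∈ Finset.Icc 3 (i - 1), (L j (j - 2) / L j j) := by
  have hrec : ∀ n, n + 4 ≤ p →
      L (n + 3) (n + 2) = -(L (n + 3) (n + 1) * L (n + 2) (n + 1)) / L (n + 2) (n + 2) := by
    intro n hn
    have hsum := hgram (n + 3) (by omega) (by omega)
    rw [show n + 3 - 1 = n + 2 by omega,
      sum_consecutive_rows_of_banded p n (by omega) L hupper hband] at hsum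
    rw [eq_div_iff (hdiag (n + 2) (by omega) (by omega))]
    linear_combination hsum
  have hclosed : ∀ n, n + 4 ≤ p →
      L (n + 3) (n + 2) = (-1 : ℝ) ^ (n + 1) * L (n + 3) (n + 1) * (L 2 1 / L 2 2) *
        ∏ j ∈ Finset.Icc 3 (n + 2), (L j (j - 2) / L j j) := by
    intro n
    induction n with
    | zero =>
      intro hn
      rw [hrec 0 hn, Finset.Icc_eq_empty (by omega), Finset.prod_empty]
      ring
    | succ n ih =>
      intro hn
      rw [hrec (n + 1) hn, show n + 1 + 2 = n + 2 + 1 by omega,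
        Finset.prod_Icc_succ_top (by omega), show n + 2 + 1 - 2 = n + 1 by omega,
        show n + 1 + 1 = n + 2 by omega, show n + 2 + 1 = n + 3 by omega, ih (by omega)]
      ring
  refine ⟨?_, fun i hi hip => ?_⟩
  · rw [hrec 0 (by omega)]
    ring
  · obtain ⟨n, rfl⟩ : ∃ n, i = n + 3 := ⟨i - 3, by omega⟩
    exact hclosed n (by omega)
end
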